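/- arXiv:2401.15436 — 7 statements merged into one kernel-verified Lean document; each statement's English description precedes it below -/
import Mathlib

section
/- For every integer p ≥ 3 and all discrete 1-forms β, γ : ℤ/pℤ → ℝ on an oriented p-gon face f, the polygonal wedge product is skew-commutative: (β ∧ γ)(f) = −(γ ∧ β)(f). -/
/-- The polygonal wedge product of two discrete 1-forms `β γ : ZMod p → ℝ`
on an oriented `p`-gon face:
`(β ∧ γ)(f) = ∑_{a=1}^{⌊(p−1)/2⌋} (1/2 − a/p) ∑_{i ∈ ℤ/pℤ} β(i)(γ(i+a) − γ(i−a))`. -/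
noncomputable def polyWedge11 (p : ℕ) [NeZero p] (β γ : ZMod p → ℝ) : ℝ :=
  ∑ a ∈ Finset.Icc 1 ((p - 1) / 2),
    ((1 : ℝ) / 2 - (a : ℝ) / (p : ℝ)) *
      ∑ i : ZMod p, β i * (γ (i + (a : ZMod p)) - γ (i - (a : ZMod p)))

/-- Shifting the summation index by `a` moves a central difference from one factor to the other,
up to sign. -/
theorem sum_mul_add_sub_sub {G R : Type*} [AddCommGroup G] [Fintype G] [CommRing R]
    (β γ : G → R) (a : G) :
    ∑ i, β i * (γ (i + a) - γ (i - a)) = -∑ i, γ i * (β (i + a) - β (i - a)) := by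
  have shift (f g : G → R) : ∑ i, f i * g (i + a) = ∑ i, g i * f (i - a) := by
    rw [← Equiv.sum_comp (Equiv.addRight a) fun i => g i * f (i - a)]
    simp [mul_comm]
  simp only [mul_sub, Finset.sum_sub_distrib]
  rw [shift β γ, shift γ β, neg_sub]

/-- Skew-commutativity of the polygonal wedge product of 1-forms. -/
theorem polyWedge11_skew_comm (p : ℕ) (hp : 3 ≤ p) [NeZero p]
    (β γ : ZMod p → ℝ) :
    polyWedge11 p β γ = - polyWedge11 p γ β := by
  rw [polyWedge11, polyWedge11, ← Finset.sum_neg_distrib]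
  refine Finset.sum_congr rfl fun a _ => ?_
  rw [sum_mul_add_sub_sub, mul_neg]
end

section
/- For every integer p ≥ 3, every discrete 0-form α : ℤ/pℤ → ℝ and every discrete 1-form β : ℤ/pℤ → ℝ on an oriented p-gon face f, the Leibniz product rule holds: d(α ∧ β)(f) = (dα ∧ β)(f) + (α ∧ dβ)(f). Explicitly, ∑_{i ∈ ℤ/pℤ} (1/2)(α(i) + α(i+1))β(i) = ∑_{a=1}^{⌊(p−1)/2⌋} (1/2 − a/p) ∑_{i ∈ ℤ/pℤ} (α(i+1) − α(i))(β(i+a) − β(i−a)) + ((1/p)∑_{i ∈ ℤ/pℤ} α(i))·(∑_{i ∈ ℤ/pℤ} β(i)). -/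
open Finset in
theorem ZMod.sum_eq_sum_range {M : Type*} [AddCommMonoid M] (p : ℕ) [NeZero p] (f : ZMod p → M) :
    ∑ k, f k = ∑ k ∈ range p, f k := by
  refine sum_nbij' ZMod.val (fun k => (k : ZMod p)) ?_ ?_ ?_ ?_ ?_
  · intro a _
    exact mem_range.2 (ZMod.val_lt a)
  · simp
  · simp
  · intro a ha
    exact ZMod.val_cast_of_lt (mem_range.1 ha)
  · simp

open Finset in
theorem ZMod.sum_range_add_sum_range_neg {M : Type*} [AddCommMonoid M] {p : ℕ} [NeZero p]
    (f : ZMod p → M) {s t : ℕ} (h : s + t = p) :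
    ∑ k ∈ range s, f k + ∑ k ∈ range t, f (-((k : ZMod p) + 1)) = ∑ k, f k := by
  induction t generalizing s with
  | zero =>
    obtain rfl : s = p := h
    simp [ZMod.sum_eq_sum_range]
  | succ t ih =>
    have hst : -((t : ZMod p) + 1) = s := by
      have h0 : ((s + (t + 1) : ℕ) : ZMod p) = 0 := by rw [h]; exact ZMod.natCast_self p
      push_cast at h0
      linear_combination -h0
    rw [← ih (s := s + 1) (by omega), sum_range_succ _ t, sum_range_succ _ s, hst]
    abel

/-- Summation by parts against the affine weights `1 / 2 - a / p`. -/
theorem sum_Icc_affine_mul_sub (x : ℝ) (D : ℕ → ℝ) (m : ℕ) :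
    ∑ a ∈ Finset.Icc 1 m, ((1 : ℝ) / 2 - (a : ℝ) / x) * (D (a - 1) - D a) =
      D 0 / 2 - 1 / x * ∑ a ∈ Finset.range m, D a - (1 / 2 - (m : ℝ) / x) * D m := by
  induction m with
  | zero => simp; ring
  | succ m ih =>
    rw [Finset.sum_Icc_succ_top (by omega), ih, Finset.sum_range_succ, Nat.add_sub_cancel]
    push_cast
    ring

/-- The cyclic cross-correlation of two functions on `ZMod p`. -/
def cyclicCorr {p : ℕ} [NeZero p] (α β : ZMod p → ℝ) (k : ZMod p) : ℝ :=
  ∑ i, α i * β (i + k)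

theorem sum_shift_mul {p : ℕ} [NeZero p] (α β : ZMod p → ℝ) (k : ZMod p) :
    ∑ i, α (i + 1) * β (i + k) = cyclicCorr α β (k - 1) :=
  Fintype.sum_equiv (Equiv.addRight 1) _ _ fun i => by simp

theorem sum_cyclicCorr {p : ℕ} [NeZero p] (α β : ZMod p → ℝ) :
    ∑ k, cyclicCorr α β k = (∑ i, α i) * ∑ i, β i := by
  simp only [cyclicCorr]
  rw [Finset.sum_comm, Finset.sum_mul]
  refine Finset.sum_congr rfl fun i _ => ?_
  rw [← Finset.mul_sum]
  congr 1
  exact Fintype.sum_equiv (Equiv.addLeft i) _ _ fun _ => rfl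

theorem sum_sub_mul_sub_eq_cyclicCorr {p : ℕ} [NeZero p] (α β : ZMod p → ℝ) (a : ZMod p) :
    ∑ i, (α (i + 1) - α i) * (β (i + a) - β (i - a)) =
      cyclicCorr α β (a - 1) + cyclicCorr α β (-a) -
        (cyclicCorr α β a + cyclicCorr α β (-(a + 1))) := by
  have h : -(a + 1) = -a - 1 := by ring
  rw [h, ← sum_shift_mul, ← sum_shift_mul]
  simp only [cyclicCorr, ← Finset.sum_add_distrib, ← Finset.sum_sub_distrib]
  refine Finset.sum_congr rfl fun i _ => ?_
  rw [← sub_eq_add_neg]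
  ring

/-- Leibniz product rule for the polygonal wedge product of a 0-form `α` and a
1-form `β` on an oriented `p`-gon face: `d(α ∧ β)(f) = (dα ∧ β)(f) + (α ∧ dβ)(f)`,
written out explicitly. Here `(dα)(e_i) = α(i+1) − α(i)`, `(dβ)(f) = ∑_i β(i)`,
`(α ∧ β)(e_i) = (1/2)(α(i)+α(i+1))β(i)`, `(α ∧ ω)(f) = ((1/p)∑_i α(i))·ω(f)` and
`(γ ∧ β)(f) = ∑_{a=1}^{⌊(p−1)/2⌋} (1/2 − a/p) ∑_i γ(i)(β(i+a) − β(i−a))`. -/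
theorem polyWedge_leibniz_01 (p : ℕ) (hp : 3 ≤ p) [NeZero p]
    (α β : ZMod p → ℝ) :
    ∑ i : ZMod p, (1 : ℝ) / 2 * (α i + α (i + 1)) * β i =
      (∑ a ∈ Finset.Icc 1 ((p - 1) / 2),
        ((1 : ℝ) / 2 - (a : ℝ) / (p : ℝ)) *
          ∑ i : ZMod p, (α (i + 1) - α i) *
            (β (i + (a : ZMod p)) - β (i - (a : ZMod p)))) +
      ((1 : ℝ) / (p : ℝ) * ∑ i : ZMod p, α i) * (∑ i : ZMod p, β i) := by
  set C := cyclicCorr α β with hC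
  have hp0 : (p : ℝ) ≠ 0 := Nat.cast_ne_zero.2 (by omega)
  have hleft : ∑ i : ZMod p, (1 : ℝ) / 2 * (α i + α (i + 1)) * β i = (C 0 + C (-1)) / 2 := by
    have h := sum_shift_mul α β 0
    rw [zero_sub] at h
    rw [hC, ← h, cyclicCorr, ← Finset.sum_add_distrib, Finset.sum_div]
    refine Finset.sum_congr rfl fun i _ => ?_
    rw [add_zero]
    ring
  let D : ℕ → ℝ := fun k => C k + C (-((k : ZMod p) + 1))
  have hwedge : ∀ a ∈ Finset.Icc 1 ((p - 1) / 2),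
      ((1 : ℝ) / 2 - (a : ℝ) / (p : ℝ)) * ∑ i : ZMod p, (α (i + 1) - α i) *
        (β (i + (a : ZMod p)) - β (i - (a : ZMod p))) =
      ((1 : ℝ) / 2 - (a : ℝ) / (p : ℝ)) * (D (a - 1) - D a) := by
    intro a ha
    rw [sum_sub_mul_sub_eq_cyclicCorr]
    simp only [D, hC, Nat.cast_sub (Finset.mem_Icc.1 ha).1, Nat.cast_one, sub_add_cancel]
  rw [Finset.sum_congr rfl hwedge, sum_Icc_affine_mul_sub, hleft, mul_assoc, ← sum_cyclicCorr]
  have hD0 : D 0 = C 0 + C (-1) := by simp [D]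
  have hsum (n : ℕ) : ∑ a ∈ Finset.range n, D a =
      ∑ k ∈ Finset.range n, C k + ∑ k ∈ Finset.range n, C (-((k : ZMod p) + 1)) :=
    Finset.sum_add_distrib
  obtain ⟨m, rfl | rfl⟩ : ∃ m, p = 2 * m + 1 ∨ p = 2 * m + 2 := ⟨(p - 1) / 2, by omega⟩
  · have hm : (2 * m + 1 - 1) / 2 = m := by omega
    have hneg : -((m : ZMod (2 * m + 1)) + 1) = m := by
      have h0 := ZMod.natCast_self (2 * m + 1)
      push_cast at h0
      linear_combination -h0
    have hDm : D m = 2 * C m := by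
      simp only [D, hneg]
      ring
    have hall := ZMod.sum_range_add_sum_range_neg C (s := m + 1) (t := m) (by omega)
    rw [Finset.sum_range_succ] at hall
    rw [hm, hD0, hsum, hDm, ← hC, ← hall]
    push_cast at hp0 ⊢
    field_simp
    ring
  · have hm : (2 * m + 2 - 1) / 2 = m := by omega
    have hall := ZMod.sum_range_add_sum_range_neg C (s := m + 1) (t := m + 1) (by omega)
    rw [← hsum, Finset.sum_range_succ] at hall
    rw [hm, hD0, ← hC, ← hall]
    push_cast at hp0 ⊢
    field_simp
    ring
end

section
/- Let p ≥ 3 and let v : ℤ/pℤ → V be the vertices of a closed p-gon in a real vector space V, with edge vectors e_i = v_{i+1} − v_i, centroid C = (1/p)∑_j v_j, and centered edge midpoints m_i = (v_i + v_{i+1})/2 − C. Then for every i ∈ ℤ/pℤ: ∑_{a=1}^{⌊(p−1)/2⌋} (1/2 − a/p)(e_{i−a} − e_{i+a}) = m_i. (In matrix terms, the transpose of the wedge-product matrix R applied to the list of edge vectors returns the centered edge midpoints.) -/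
/-- Summing a function on `ZMod p` along `p` consecutive residues gives its total sum. -/
theorem ZMod.sum_range_add_natCast {M : Type*} [AddCommMonoid M] (p : ℕ) [NeZero p]
    (f : ZMod p → M) (c : ZMod p) :
    ∑ k ∈ Finset.range p, f (c + (k : ZMod p)) = ∑ j : ZMod p, f j := by
  rw [← Equiv.sum_comp (Equiv.addLeft c) f]
  refine Finset.sum_bij' (fun k _ => (k : ZMod p)) (fun j _ => j.val) ?_ ?_ ?_ ?_ ?_
  · simp
  · intro j _
    exact Finset.mem_range.2 (ZMod.val_lt j)
  · intro k hk
    exact ZMod.val_cast_of_lt (Finset.mem_range.1 hk)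
  · intro j _
    exact ZMod.natCast_zmod_val j
  · intro k _
    rfl

/-- Folding a sum over an even number of consecutive points about its centre. -/
theorem Finset.sum_range_symmetric_pairs {R M : Type*} [CommRing R] [AddCommMonoid M]
    (f : R → M) (i : R) (n : ℕ) :
    ∑ k ∈ Finset.range (n + 1), (f (i - (k : R)) + f (i + 1 + (k : R))) =
      ∑ k ∈ Finset.range (2 * n + 2), f (i - (n : R) + (k : R)) := by
  induction n with
  | zero => simp [Finset.sum_range_succ]
  | succ n ih =>
    rw [Finset.sum_range_succ, ih, show 2 * (n + 1) + 2 = 2 * n + 2 + 1 + 1 by ring,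
      Finset.sum_range_succ _ (2 * n + 2 + 1), Finset.sum_range_succ' _ (2 * n + 2)]
    have h (k : ℕ) : i - ((n + 1 : ℕ) : R) + ((k + 1 : ℕ) : R) = i - (n : R) + (k : R) := by
      push_cast; ring
    simp only [h]
    rw [show i - (n : R) + ((2 * n + 2 : ℕ) : R) = i + 1 + ((n + 1 : ℕ) : R) by
      push_cast; ring, Nat.cast_zero, add_zero]
    exact (add_assoc _ _ _).symm

/-- Summation by parts with weights `1 / 2 - a / p`. -/
theorem sum_Icc_weight_smul_sub {V : Type*} [AddCommGroup V] [Module ℝ V]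
    (p : ℝ) (u : ℕ → V) (n : ℕ) :
    ∑ a ∈ Finset.Icc 1 n, ((1 : ℝ) / 2 - (a : ℝ) / p) • (u (a - 1) - u a) =
      (2 : ℝ)⁻¹ • u 0 - p⁻¹ • ∑ a ∈ Finset.range (n + 1), u a
        - ((1 : ℝ) / 2 - ((n : ℝ) + 1) / p) • u n := by
  induction n with
  | zero =>
    simp
    module
  | succ n ih =>
    rw [Finset.sum_Icc_succ_top (by omega), ih, Finset.sum_range_succ _ (n + 1),
      Nat.add_sub_cancel]
    push_cast
    module

/-- For a closed `p`-gon with vertices `v : ZMod p → V` in a real vector space,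
edge vectors `e_i = v_{i+1} − v_i`, centroid `C = (1/p)∑_j v_j`, and centered
edge midpoints `m_i = (v_i + v_{i+1})/2 − C`, we have for every `i`:
`∑_{a=1}^{⌊(p−1)/2⌋} (1/2 − a/p)(e_{i−a} − e_{i+a}) = m_i`. -/
theorem polyWedge_R_transpose_edges_eq_centered_midpoints
    (p : ℕ) (hp : 3 ≤ p) [NeZero p]
    (V : Type*) [AddCommGroup V] [Module ℝ V]
    (v : ZMod p → V)
    (e : ZMod p → V) (he : ∀ i, e i = v (i + 1) - v i)
    (C : V) (hC : C = ((p : ℝ))⁻¹ • ∑ j : ZMod p, v j)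
    (m : ZMod p → V) (hm : ∀ i, m i = ((2 : ℝ))⁻¹ • (v i + v (i + 1)) - C)
    (i : ZMod p) :
    ∑ a ∈ Finset.Icc 1 ((p - 1) / 2),
      ((1 : ℝ) / 2 - (a : ℝ) / (p : ℝ)) •
        (e (i - (a : ZMod p)) - e (i + (a : ZMod p))) = m i := by
  set n := (p - 1) / 2 with hn
  have hp0 : (p : ℝ) ≠ 0 := by positivity
  let u : ℕ → V := fun a => v (i - (a : ZMod p)) + v (i + 1 + (a : ZMod p))
  have hu : ∀ a ∈ Finset.Icc 1 n,
      ((1 : ℝ) / 2 - (a : ℝ) / (p : ℝ)) • (e (i - (a : ZMod p)) - e (i + (a : ZMod p))) =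
        ((1 : ℝ) / 2 - (a : ℝ) / (p : ℝ)) • (u (a - 1) - u a) := by
    intro a ha
    have ha1 : 1 ≤ a := (Finset.mem_Icc.1 ha).1
    simp only [u, he, Nat.cast_sub ha1, Nat.cast_one]
    rw [show i - ((a : ZMod p) - 1) = i - a + 1 by ring,
      show i + 1 + ((a : ZMod p) - 1) = i + a by ring,
      show i + 1 + (a : ZMod p) = i + a + 1 by ring]
    module
  have hfold : ∑ k ∈ Finset.range (n + 1), u k =
      ∑ k ∈ Finset.range (2 * n + 2), v (i - (n : ZMod p) + (k : ZMod p)) :=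
    Finset.sum_range_symmetric_pairs v i n
  rw [Finset.sum_congr rfl hu, sum_Icc_weight_smul_sub, hfold, hm, hC,
    ← ZMod.sum_range_add_natCast p v (i - (n : ZMod p))]
  have hu0 : u 0 = v i + v (i + 1) := by simp [u]
  rw [hu0]
  obtain hpn | hpn : p = 2 * n + 2 ∨ p = 2 * n + 1 := by omega
  · have hw : (1 : ℝ) / 2 - ((n : ℝ) + 1) / p = 0 := by
      have : (p : ℝ) = 2 * n + 2 := by exact_mod_cast hpn
      field_simp
      linarith
    rw [hw, zero_smul, sub_zero, ← hpn]
  · have hw : (1 : ℝ) / 2 - ((n : ℝ) + 1) / p = -(2⁻¹ * (p : ℝ)⁻¹) := by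
      have : (p : ℝ) = 2 * n + 1 := by exact_mod_cast hpn
      field_simp
      linarith
    have hun : u n = (2 : ℝ) • v (i - (n : ZMod p)) := by
      have h : (2 * (n : ZMod p) + 1) = 0 := by
        have := ZMod.natCast_self p
        rw [congrArg (Nat.cast : ℕ → ZMod p) hpn] at this
        exact_mod_cast this
      have h' : i + 1 + (n : ZMod p) = i - n := by linear_combination h
      simp only [u, h', two_smul]
    rw [show 2 * n + 2 = p + 1 by omega, Finset.sum_range_succ, ZMod.natCast_self, add_zero,
      hw, hun]
    module
end

section
/- Let p ≥ 3 and let v : ℤ/pℤ → V be the vertices of a closed p-gon in a real inner product space V, with edge vectors e_i = v_{i+1} − v_i, centroid C = (1/p)∑_j v_j, and centered edge midpoints m_i = (v_i + v_{i+1})/2 − C. Then for all i, j ∈ ℤ/pℤ: ⟨ ∑_{a=1}^{⌊(p−1)/2⌋} (1/2 − a/p)(e_{i−a} − e_{i+a}), ∑_{b=1}^{⌊(p−1)/2⌋} (1/2 − b/p)(e_{j−b} − e_{j+b}) ⟩ = ⟨m_i, m_j⟩. Consequently, on a single face with vector area |f| > 0, the per-face matrix R W₁ Rᵀ of the polygonal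 Hodge inner product of 1-forms (with W₁[i,j] = ⟨e_i, e_j⟩/|f|) is identical to the Alexa–Wardetzky matrix M_f = (1/|f|) B_f B_fᵀ, where the rows of B_f are the edge midpoints relative to the centroid. -/
open scoped RealInnerProductSpace Matrix

/-- The matrix `R_a` with `R_a[k, k+a] = 1`, `R_a[k, k−a] = −1` (indices mod `p`)
and all other entries `0`. -/
def polyRa (p : ℕ) [NeZero p] (a : ℕ) : Matrix (ZMod p) (ZMod p) ℝ :=
  Matrix.of fun k j =>
    if j = k + (a : ZMod p) then 1 else if j = k - (a : ZMod p) then -1 else 0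

/-- The wedge-product matrix `R = ∑_{a=1}^{⌊(p−1)/2⌋} (1/2 − a/p) R_a`. -/
noncomputable def polyR (p : ℕ) [NeZero p] : Matrix (ZMod p) (ZMod p) ℝ :=
  ∑ a ∈ Finset.Icc 1 ((p - 1) / 2),
    ((1 : ℝ) / 2 - (a : ℝ) / (p : ℝ)) • polyRa p a

namespace ZMod

variable {p : ℕ} [NeZero p]

/-- Summing over `p` consecutive residues is summing over `ZMod p`. -/
lemma sum_range_add_natCast_s5 {M : Type*} [AddCommMonoid M] (f : ZMod p → M) (c : ZMod p) :
    ∑ a ∈ Finset.range p, f (c + (a : ZMod p)) = ∑ j, f j := by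
  refine Finset.sum_nbij' (fun a => c + (a : ZMod p)) (fun x => (x - c).val) ?_ ?_ ?_ ?_ ?_
  · simp
  · intro x _
    simpa using (x - c).val_lt
  · intro a ha
    simpa using val_cast_of_lt (Finset.mem_range.mp ha)
  · simp
  · simp

/-- The residues `i, i - 1, …, i - (k - 1)` and `i + 1, …, i + l` exhaust `ZMod (k + l)`. -/
lemma sum_range_sub_add_sum_range_add {M : Type*} [AddCommMonoid M] (f : ZMod p → M)
    (i : ZMod p) {k l : ℕ} (hkl : k + l = p) :
    ∑ a ∈ Finset.range k, f (i - (a : ZMod p)) +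
      ∑ a ∈ Finset.range l, f (i + 1 + (a : ZMod p)) = ∑ j, f j := by
  rw [← sum_range_add_natCast_s5 f (i + 1 - (k : ZMod p)),
    congrArg Finset.range hkl.symm, Finset.sum_range_add, ← Finset.sum_range_reflect]
  congr 1
  · refine Finset.sum_congr rfl fun a ha => congrArg f ?_
    have hak : a + 1 ≤ k := Finset.mem_range.mp ha
    rw [Nat.sub_sub, add_comm 1 a, Nat.cast_sub hak]
    push_cast
    ring
  · refine Finset.sum_congr rfl fun a _ => congrArg f ?_
    push_cast
    ring

end ZMod

/-- Summation by parts for the weighted sum of edge differences of a polygon. -/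
lemma sum_smul_edge_sub_edge {p : ℕ} {V : Type*} [AddCommGroup V] [Module ℝ V]
    (v : ZMod p → V) (i : ZMod p) (n : ℕ) :
    ∑ a ∈ Finset.Icc 1 n, ((1 : ℝ) / 2 - (a : ℝ) / (p : ℝ)) •
        ((v (i - (a : ZMod p) + 1) - v (i - (a : ZMod p))) -
          (v (i + (a : ZMod p) + 1) - v (i + (a : ZMod p)))) =
      (2 : ℝ)⁻¹ • (v i + v (i + 1)) -
        (p : ℝ)⁻¹ • (∑ a ∈ Finset.range n, v (i - (a : ZMod p)) +
          ∑ a ∈ Finset.range n, v (i + 1 + (a : ZMod p))) -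
        ((1 : ℝ) / 2 - (n : ℝ) / (p : ℝ)) •
          (v (i - (n : ZMod p)) + v (i + 1 + (n : ZMod p))) := by
  induction n with
  | zero => simp
  | succ n ih =>
    rw [Finset.sum_Icc_succ_top (by omega), ih, Finset.sum_range_succ, Finset.sum_range_succ]
    have hsub : i - ((n + 1 : ℕ) : ZMod p) + 1 = i - n := by push_cast; ring
    have hadd : i + ((n + 1 : ℕ) : ZMod p) = i + 1 + n := by push_cast; ring
    have hadd' : i + 1 + (n : ZMod p) + 1 = i + 1 + ((n + 1 : ℕ) : ZMod p) := by push_cast; ring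
    rw [hsub, hadd, hadd', Nat.cast_succ (R := ℝ)]
    module

/-- The weighted sum of edge differences at an edge is its centered midpoint. -/
lemma sum_smul_edge_sub_edge_eq_midpoint {p : ℕ} [NeZero p] {V : Type*} [AddCommGroup V]
    [Module ℝ V] (v : ZMod p → V) (i : ZMod p) :
    ∑ a ∈ Finset.Icc 1 ((p - 1) / 2), ((1 : ℝ) / 2 - (a : ℝ) / (p : ℝ)) •
        ((v (i - (a : ZMod p) + 1) - v (i - (a : ZMod p))) -
          (v (i + (a : ZMod p) + 1) - v (i + (a : ZMod p)))) =
      (2 : ℝ)⁻¹ • (v i + v (i + 1)) - (p : ℝ)⁻¹ • ∑ j, v j := by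
  rw [sum_smul_edge_sub_edge]
  have hp : (p : ℝ) ≠ 0 := NeZero.ne _
  have hpos : 0 < p := NeZero.pos p
  generalize hn : (p - 1) / 2 = n
  obtain hpn | hpn : (n + 1) + (n + 1) = p ∨ (n + 1) + n = p := by omega
  · have hw : (1 : ℝ) / 2 - (n : ℝ) / p = (p : ℝ)⁻¹ := by
      have hpn' : (p : ℝ) = (n + 1) + (n + 1) := by exact_mod_cast hpn.symm
      field_simp
      linarith
    rw [hw, ← ZMod.sum_range_sub_add_sum_range_add v i hpn, Finset.sum_range_succ,
      Finset.sum_range_succ]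
    module
  · have hw : (1 : ℝ) / 2 - (n : ℝ) / p = (2 : ℝ)⁻¹ * (p : ℝ)⁻¹ := by
      have hpn' : (p : ℝ) = (n + 1) + n := by exact_mod_cast hpn.symm
      field_simp
      linarith
    have hmeet : i + 1 + (n : ZMod p) = i - n := by
      have hpn' : ((n : ZMod p) + 1) + n = 0 := by
        have h := congrArg (Nat.cast : ℕ → ZMod p) hpn
        simpa using h
      linear_combination hpn'
    rw [hw, hmeet, ← ZMod.sum_range_sub_add_sum_range_add v i hpn, Finset.sum_range_succ]
    module

lemma sum_polyRa_smul {p : ℕ} [NeZero p] {V : Type*} [AddCommGroup V] [Module ℝ V]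
    (e : ZMod p → V) (i : ZMod p) {a : ℕ} (ha : 0 < a) (hap : 2 * a < p) :
    ∑ k, polyRa p a i k • e k = e (i + (a : ZMod p)) - e (i - (a : ZMod p)) := by
  have hne : i - (a : ZMod p) ≠ i + a := by
    intro h
    have h2 : ((2 * a : ℕ) : ZMod p) = 0 := by
      push_cast
      linear_combination -h
    rw [ZMod.natCast_eq_zero_iff] at h2
    exact absurd (Nat.le_of_dvd (by omega) h2) (by omega)
  have hentry : ∀ k, polyRa p a i k • e k =
      (if k = i + (a : ZMod p) then e k else 0) - (if k = i - (a : ZMod p) then e k else 0) := by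
    intro k
    by_cases h₁ : k = i + (a : ZMod p)
    · simp [polyRa, h₁, hne.symm]
    · by_cases h₂ : k = i - (a : ZMod p) <;> simp [polyRa, h₁, h₂, hne]
  simp [hentry]

lemma sum_polyR_smul {p : ℕ} [NeZero p] {V : Type*} [AddCommGroup V] [Module ℝ V]
    (e : ZMod p → V) (i : ZMod p) :
    ∑ k, polyR p i k • e k =
      -∑ a ∈ Finset.Icc 1 ((p - 1) / 2), ((1 : ℝ) / 2 - (a : ℝ) / (p : ℝ)) •
        (e (i - (a : ZMod p)) - e (i + (a : ZMod p))) := by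
  simp only [polyR, Matrix.sum_apply, Matrix.smul_apply, Finset.sum_smul, smul_assoc]
  rw [Finset.sum_comm, ← Finset.sum_neg_distrib]
  refine Finset.sum_congr rfl fun a ha => ?_
  rw [Finset.mem_Icc] at ha
  rw [← Finset.smul_sum, sum_polyRa_smul e i (by omega) (by omega), ← smul_neg, neg_sub]

/-- For a closed `p`-gon with vertices `v : ZMod p → V` in a real inner product
space, edge vectors `e_i = v_{i+1} − v_i`, centroid `C`, and centered edge
midpoints `m_i`, for all `i, j`:
`⟨∑_a (1/2 − a/p)(e_{i−a} − e_{i+a}), ∑_b (1/2 − b/p)(e_{j−b} − e_{j+b})⟩ = ⟨m_i, m_j⟩`.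
Consequently, on a single face of vector area `A > 0`, the per-face Hodge inner
product matrix `R W₁ Rᵀ` (with `W₁[i,j] = ⟨e_i, e_j⟩/A`) equals the
Alexa–Wardetzky matrix `M_f = (1/A) B_f B_fᵀ`, i.e. `(M_f)[i,j] = ⟨m_i, m_j⟩/A`. -/
theorem polyHodgeInner1_eq_AlexaWardetzky
    (p : ℕ) (hp : 3 ≤ p) [NeZero p]
    (V : Type*) [NormedAddCommGroup V] [InnerProductSpace ℝ V]
    (v : ZMod p → V)
    (e : ZMod p → V) (he : ∀ i, e i = v (i + 1) - v i)
    (C : V) (hC : C = ((p : ℝ))⁻¹ • ∑ j : ZMod p, v j)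
    (m : ZMod p → V) (hm : ∀ i, m i = ((2 : ℝ))⁻¹ • (v i + v (i + 1)) - C)
    (A : ℝ) (hA : 0 < A)
    (W₁ : Matrix (ZMod p) (ZMod p) ℝ) (hW₁ : W₁ = Matrix.of fun i j => ⟪e i, e j⟫ / A) :
    (∀ i j : ZMod p,
      ⟪∑ a ∈ Finset.Icc 1 ((p - 1) / 2),
          ((1 : ℝ) / 2 - (a : ℝ) / (p : ℝ)) •
            (e (i - (a : ZMod p)) - e (i + (a : ZMod p))),
        ∑ b ∈ Finset.Icc 1 ((p - 1) / 2),
          ((1 : ℝ) / 2 - (b : ℝ) / (p : ℝ)) •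
            (e (j - (b : ZMod p)) - e (j + (b : ZMod p)))⟫ = ⟪m i, m j⟫) ∧
    polyR p * W₁ * (polyR p)ᵀ = Matrix.of fun i j => ⟪m i, m j⟫ / A := by
  have hsum : ∀ i, ∑ a ∈ Finset.Icc 1 ((p - 1) / 2), ((1 : ℝ) / 2 - (a : ℝ) / (p : ℝ)) •
      (e (i - (a : ZMod p)) - e (i + (a : ZMod p))) = m i := by
    intro i
    simp only [he, hm, hC]
    exact sum_smul_edge_sub_edge_eq_midpoint v i
  refine ⟨fun i j => by rw [hsum, hsum], ?_⟩
  have hR : ∀ i, ∑ k, polyR p i k • e k = -m i := fun i => by rw [sum_polyR_smul, hsum]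
  ext i j
  rw [Matrix.of_apply, ← inner_neg_neg, ← hR i, ← hR j]
  simp only [hW₁, Matrix.mul_apply, Matrix.transpose_apply, Matrix.of_apply, inner_sum, sum_inner,
    real_inner_smul_left, real_inner_smul_right, Finset.sum_mul, Finset.sum_div]
  refine Finset.sum_congr rfl fun l _ => Finset.sum_congr rfl fun k _ => ?_
  ring
end

section
/- Let p ≥ 3 and let v : ℤ/pℤ → V be the vertices of a closed p-gon face f in a real inner product space V, with edge vectors e_i = v_{i+1} − v_i and vector area |f| > 0. For every discrete 1-form β : ℤ/pℤ → ℝ, the per-face Hodge inner product is nonnegative: (β ∧ ⋆₁β)(f) = (1/|f|)·‖ ∑_{j ∈ ℤ/pℤ} c_j e_j ‖² ≥ 0, where c_j = ∑_{a=1}^{⌊(p−1)/2⌋} (1/2 − a/p)(β(j−a) − β(j+a)). -/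
open scoped RealInnerProductSpace

/-- Summation by parts: shifting the indices moves the centred difference, up to sign, from one
factor to the other. -/
theorem sum_mul_sub_shift {G R : Type*} [AddCommGroup G] [Fintype G] [CommRing R]
    (β γ : G → R) (a : G) :
    ∑ i, β i * (γ (i + a) - γ (i - a)) = ∑ i, (β (i - a) - β (i + a)) * γ i := by
  have h₁ : ∑ i, β i * γ (i + a) = ∑ i, β (i - a) * γ i :=
    Fintype.sum_equiv (Equiv.addRight a) _ _ fun i => by simp
  have h₂ : ∑ i, β i * γ (i - a) = ∑ i, β (i + a) * γ i :=
    Fintype.sum_equiv (Equiv.subRight a) _ _ fun i => by simp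
  simp only [mul_sub, sub_mul, Finset.sum_sub_distrib, h₁, h₂]

/-- The polygonal wedge product with the averaged differences applied to the first factor. -/
theorem polyWedge11_eq_sum_mul (p : ℕ) [NeZero p] (β γ : ZMod p → ℝ) :
    polyWedge11 p β γ = ∑ j : ZMod p, (∑ a ∈ Finset.Icc 1 ((p - 1) / 2),
      ((1 : ℝ) / 2 - (a : ℝ) / (p : ℝ)) *
        (β (j - (a : ZMod p)) - β (j + (a : ZMod p)))) * γ j := by
  simp only [polyWedge11, sum_mul_sub_shift, Finset.mul_sum, Finset.sum_mul, mul_assoc]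
  exact Finset.sum_comm

/-- On a closed `p`-gon face with edge vectors `e_i = v_{i+1} − v_i` and vector
area `A > 0`, the per-face Hodge inner product of a 1-form `β` with itself is
`(β ∧ ⋆₁β)(f) = (1/A)·‖∑_j c_j e_j‖² ≥ 0`, where
`c_j = ∑_{a=1}^{⌊(p−1)/2⌋} (1/2 − a/p)(β(j−a) − β(j+a))` and
`(⋆₁β)(e_i) = (1/A) ∑_j ⟨e_i, e_j⟩ c_j`. -/
theorem polyHodgeInner1_self_nonneg
    (p : ℕ) (hp : 3 ≤ p) [NeZero p]
    (V : Type*) [NormedAddCommGroup V] [InnerProductSpace ℝ V]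
    (v : ZMod p → V)
    (e : ZMod p → V) (he : ∀ i, e i = v (i + 1) - v i)
    (A : ℝ) (hA : 0 < A)
    (β : ZMod p → ℝ)
    (c : ZMod p → ℝ)
    (hc : ∀ j, c j = ∑ a ∈ Finset.Icc 1 ((p - 1) / 2),
      ((1 : ℝ) / 2 - (a : ℝ) / (p : ℝ)) *
        (β (j - (a : ZMod p)) - β (j + (a : ZMod p))))
    (starβ : ZMod p → ℝ)
    (hstarβ : ∀ i, starβ i = (1 / A) * ∑ j : ZMod p, ⟪e i, e j⟫ * c j) :
    polyWedge11 p β starβ = (1 / A) * ‖∑ j : ZMod p, c j • e j‖ ^ 2 ∧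
      0 ≤ polyWedge11 p β starβ := by
  have key : polyWedge11 p β starβ = (1 / A) * ‖∑ j : ZMod p, c j • e j‖ ^ 2 := by
    rw [polyWedge11_eq_sum_mul, ← real_inner_self_eq_norm_sq]
    simp only [← hc, hstarβ, sum_inner, inner_sum, real_inner_smul_left, real_inner_smul_right,
      Finset.mul_sum]
    exact Finset.sum_congr rfl fun i _ => Finset.sum_congr rfl fun j _ => by
      rw [real_inner_comm]
      ring
  exact ⟨key, key ▸ by positivity⟩
end

section
/- Let p ≥ 3 and let v : ℤ/pℤ → ℝ² be the vertices of a closed planar p-gon, with edge vectors e_i = v_{i+1} − v_i, centroid C = (1/p)∑_j v_j, centered edge midpoints m_i = (v_i + v_{i+1})/2 − C, and signed area A = (1/2)∑_{j ∈ ℤ/pℤ} ((v_j)_x (v_{j+1})_y − (v_j)_y (v_{j+1})_x). Then for every u ∈ ℝ²: ∑_{j ∈ ℤ/pℤ} ⟨u, m_j⟩ e_j = A · J u, where J(u_x, u_y) = (−u_y, u_x) is rotation by 90 degrees. -/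
/-- The Euclidean inner product on ℝ². -/
def dot2 (u w : Fin 2 → ℝ) : ℝ := u 0 * w 0 + u 1 * w 1

/-- Counterclockwise rotation by 90 degrees: `J(u_x, u_y) = (−u_y, u_x)`. -/
def rot90 (u : Fin 2 → ℝ) : Fin 2 → ℝ := ![-u 1, u 0]

/-- A cyclic telescoping sum vanishes. -/
theorem sum_zmod_add_one_sub_eq_zero {p : ℕ} [NeZero p] {M : Type*} [AddCommGroup M]
    (g : ZMod p → M) : ∑ j : ZMod p, (g (j + 1) - g j) = 0 := by
  rw [Finset.sum_sub_distrib, sub_eq_zero]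
  exact Equiv.sum_comp (Equiv.addRight (1 : ZMod p)) g

/-- For a closed planar `p`-gon with vertices `v : ZMod p → ℝ²`, edge vectors
`e_i = v_{i+1} − v_i`, centroid `C = (1/p)∑_j v_j`, centered edge midpoints
`m_i = (v_i + v_{i+1})/2 − C`, and signed area
`A = (1/2)∑_j ((v_j)_x (v_{j+1})_y − (v_j)_y (v_{j+1})_x)`, for every `u ∈ ℝ²`:
`∑_j ⟨u, m_j⟩ e_j = A · J u`. -/
theorem sum_dot_centered_midpoints_smul_edges
    (p : ℕ) (hp : 3 ≤ p) [NeZero p]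
    (v : ZMod p → Fin 2 → ℝ)
    (e : ZMod p → Fin 2 → ℝ) (he : ∀ i, e i = v (i + 1) - v i)
    (C : Fin 2 → ℝ) (hC : C = ((p : ℝ))⁻¹ • ∑ j : ZMod p, v j)
    (m : ZMod p → Fin 2 → ℝ) (hm : ∀ i, m i = ((2 : ℝ))⁻¹ • (v i + v (i + 1)) - C)
    (A : ℝ)
    (hA : A = (1 : ℝ) / 2 * ∑ j : ZMod p, (v j 0 * v (j + 1) 1 - v j 1 * v (j + 1) 0))
    (u : Fin 2 → ℝ) :
    ∑ j : ZMod p, dot2 u (m j) • e j = A • rot90 u := by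
  have key (k : Fin 2) (c : ℝ) (g : ZMod p → ℝ)
      (h : ∀ j, dot2 u (m j) * e j k =
        1 / 2 * c * (v j 0 * v (j + 1) 1 - v j 1 * v (j + 1) 0) + (g (j + 1) - g j)) :
      ∑ j : ZMod p, dot2 u (m j) * e j k = A * c := by
    simp_rw [h]
    rw [Finset.sum_add_distrib, sum_zmod_add_one_sub_eq_zero, ← Finset.mul_sum, hA]
    ring
  ext k
  rw [Finset.sum_apply]
  fin_cases k
  · refine key 0 (-u 1) (fun j => u 0 * (v j 0 ^ 2 / 2 - C 0 * v j 0)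
      + u 1 * (v j 0 * v j 1 / 2 - C 1 * v j 0)) fun j => ?_
    simp only [dot2, hm, he, Pi.sub_apply, Pi.add_apply, Pi.smul_apply, smul_eq_mul]
    ring
  · refine key 1 (u 0) (fun j => u 0 * (v j 0 * v j 1 / 2 - C 0 * v j 1)
      + u 1 * (v j 1 ^ 2 / 2 - C 1 * v j 1)) fun j => ?_
    simp only [dot2, hm, he, Pi.sub_apply, Pi.add_apply, Pi.smul_apply, smul_eq_mul]
    ring
end

section
/- Let n, X, e₁, e₂ ∈ ℝ³ with ‖n‖ = 1 and ⟨X, n⟩ = ⟨e₁, n⟩ = ⟨e₂, n⟩ = 0. Then ⟨X, e₂⟩ (n × e₁) − ⟨X, e₁⟩ (n × e₂) = ⟨e₁ × e₂, n⟩ · X. In particular, the vector (⟨X, e₂⟩/(|e₁||e₂|))(n × e₁) − (⟨X, e₁⟩/(|e₁||e₂|))(n × e₂) produced by the discrete sharp operator from the flat of a tangent vector X is a nonnegative scalar multiple of X whenever ⟨e₁ × e₂, n⟩ > 0, so it has the same direction as X. -/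
/-- The Euclidean inner product on ℝ³. -/
def dot3 (u w : Fin 3 → ℝ) : ℝ := u 0 * w 0 + u 1 * w 1 + u 2 * w 2

/-- The double cross product `n × (X × (e₁ × e₂))`, expanded in two ways, for `X` orthogonal
to `n`. -/
theorem smul_cross_sub_smul_cross_of_dot3_eq_zero (n X e₁ e₂ : Fin 3 → ℝ) (hX : dot3 X n = 0) :
    dot3 X e₂ • crossProduct n e₁ - dot3 X e₁ • crossProduct n e₂ =
      dot3 (crossProduct e₁ e₂) n • X := by
  unfold dot3 at *
  ext i
  fin_cases i <;> simp [cross_apply]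
  · linear_combination (-(e₁ 1 * e₂ 2 - e₁ 2 * e₂ 1)) * hX
  · linear_combination (-(e₁ 2 * e₂ 0 - e₁ 0 * e₂ 2)) * hX
  · linear_combination (-(e₁ 0 * e₂ 1 - e₁ 1 * e₂ 0)) * hX

/-- Let `n, X, e₁, e₂ ∈ ℝ³` with `‖n‖ = 1` and `⟨X, n⟩ = ⟨e₁, n⟩ = ⟨e₂, n⟩ = 0`.
Then `⟨X, e₂⟩ (n × e₁) − ⟨X, e₁⟩ (n × e₂) = ⟨e₁ × e₂, n⟩ · X`.  In particular,
the vector `(⟨X, e₂⟩/(|e₁||e₂|))(n × e₁) − (⟨X, e₁⟩/(|e₁||e₂|))(n × e₂)` produced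
by the discrete sharp operator from the flat of `X` is a nonnegative scalar
multiple of `X` whenever `⟨e₁ × e₂, n⟩ > 0`, so it has the same direction as `X`. -/
theorem discrete_sharp_of_flat_parallel
    (n X e₁ e₂ : Fin 3 → ℝ)
    (hn : dot3 n n = 1)
    (hX : dot3 X n = 0) (h₁ : dot3 e₁ n = 0) (h₂ : dot3 e₂ n = 0) :
    dot3 X e₂ • crossProduct n e₁ - dot3 X e₁ • crossProduct n e₂ =
      dot3 (crossProduct e₁ e₂) n • X ∧
    (0 < dot3 (crossProduct e₁ e₂) n →
      ∃ c : ℝ, 0 ≤ c ∧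
        (dot3 X e₂ / (Real.sqrt (dot3 e₁ e₁) * Real.sqrt (dot3 e₂ e₂))) • crossProduct n e₁ -
          (dot3 X e₁ / (Real.sqrt (dot3 e₁ e₁) * Real.sqrt (dot3 e₂ e₂))) • crossProduct n e₂ =
            c • X) := by
  have key := smul_cross_sub_smul_cross_of_dot3_eq_zero n X e₁ e₂ hX
  refine ⟨key, fun hpos =>
    ⟨dot3 (crossProduct e₁ e₂) n / (Real.sqrt (dot3 e₁ e₁) * Real.sqrt (dot3 e₂ e₂)),
      by positivity, ?_⟩⟩
  simp only [div_eq_inv_mul, mul_smul, ← smul_sub, key]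
end
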